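/- Let k, N ≥ 1 with k² ≤ 2^N and let ε' ≥ 0. Let μ be a Borel probability measure on U(2^N) whose k-fold channel Φ(X) := ∫ U^{⊗k}·X·U^{†⊗k} dμ(U) satisfies: both Φ − (1−ε')·Φ_H and (1+ε')·Φ_H − Φ are completely positive, where Φ_H is the k-fold channel of a Haar-random element of U(2^N) (i.e., μ is a unitary k-design with ε' relative error). Let |EPR⟩ := 2^{−N/2}·∑_{x∈𝔽₂^N} e_x⊗e_x ∈ ℂ^{2^N}⊗ℂ^{2^N} and ρ_E := ∫ ((U⊗I)·|EPR⟩⟨EPR|·(U⊗I)†)^{⊗k} dμ(U). Then, with ε := (1+ε')·(1+k²·2^{−N})·(1+k²·2^{−2N}) − 1, both ρ_E − (1−ε)·ρ_H^{(k)} and (1+ε)·ρ_H^{(k)} − ρ_E are positive semidefinite, where ρ_H^{(k)} := P_sym/Tr P_sym on (ℂ^{2^{2N}})^{⊗k}. (This is the paper's lemma that the Choi state of a relative-error unitary k-design forms a relative-error state k-design on the doubled system.) -/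

import Mathlib

open MeasureTheory Matrix
open scoped ComplexOrder Classical BigOperators

noncomputable section

/-- The induced map `Φ ⊗ id` on matrices over the doubled index type; for linear `Φ`
it is the unique linear map with `(Φ ⊗ id)(A ⊗ B) = Φ(A) ⊗ B`. -/
def tensorId {n : Type*} (Φ : Matrix n n ℂ → Matrix n n ℂ)
    (O : Matrix (n × n) (n × n) ℂ) : Matrix (n × n) (n × n) ℂ :=
  Matrix.of fun p q => Φ (Matrix.of fun a c => O (a, p.2) (c, q.2)) p.1 q.1

/-- Complete positivity: `Φ ⊗ id` maps positive semidefinite matrices to positive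
semidefinite matrices. -/
def CompletelyPositive {n : Type*} [Fintype n] (Φ : Matrix n n ℂ → Matrix n n ℂ) : Prop :=
  ∀ O : Matrix (n × n) (n × n) ℂ, O.PosSemidef → (tensorId Φ O).PosSemidef

/-- `k`-fold tensor (Kronecker) power of a matrix. -/
def tpow (k : ℕ) {β : Type*} (M : Matrix β β ℂ) :
    Matrix (Fin k → β) (Fin k → β) ℂ :=
  Matrix.of fun X Y => ∏ a, M (X a) (Y a)

/-- The matrix `R(π)` permuting the `k` tensor factors of `(ℂ^β)^{⊗k}`. -/
def permMat (k : ℕ) (β : Type*) (π : Equiv.Perm (Fin k)) :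
    Matrix (Fin k → β) (Fin k → β) ℂ :=
  Matrix.of fun X Y => if ∀ a, X a = Y (π a) then (1 : ℂ) else 0

/-- `P_sym = (1/k!) ∑_{π ∈ S_k} R(π)`, the orthogonal projection onto the symmetric
subspace of the `k`-fold tensor power. -/
def Psym (k : ℕ) (β : Type*) [Fintype β] : Matrix (Fin k → β) (Fin k → β) ℂ :=
  ((Nat.factorial k : ℂ))⁻¹ • ∑ π : Equiv.Perm (Fin k), permMat k β π

/-- `ρ_H^{(k)} = P_sym / Tr P_sym`, the `k`-th moment of a Haar-random unit vector in
`ℂ^d` with `d = card β`; here `Tr P_sym = C(d + k - 1, k)`. -/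
def rhoHaar (k : ℕ) (β : Type*) [Fintype β] : Matrix (Fin k → β) (Fin k → β) ℂ :=
  ((Nat.choose (Fintype.card β + k - 1) k : ℂ))⁻¹ • Psym k β

instance matrixMeasurableSpace {ι κ : Type*} : MeasurableSpace (Matrix ι κ ℂ) :=
  (inferInstance : MeasurableSpace (ι → κ → ℂ))

/-- The set of unitary matrices. -/
def UnitarySet (ι : Type*) [Fintype ι] [DecidableEq ι] : Set (Matrix ι ι ℂ) :=
  (Matrix.unitaryGroup ι ℂ : Set (Matrix ι ι ℂ))

/-- `μ` is the Haar probability measure of the compact matrix group with carrier `G`: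
a Borel probability measure supported on `G` that is invariant under left translation
by every element of `G`. -/
def IsHaarOn {ι : Type*} [Fintype ι] [DecidableEq ι] (G : Set (Matrix ι ι ℂ))
    (μ : Measure (Matrix ι ι ℂ)) : Prop :=
  IsProbabilityMeasure μ ∧ μ G = 1 ∧
    ∀ g ∈ G, Measure.map (fun M => g * M) μ = μ

/-- The `k`-fold channel `X ↦ E_{U ∼ μ}[U^{⊗k} X (U^{⊗k})†]` of an ensemble `μ` of
matrices, defined entrywise by Bochner integrals. -/
def kfold (k : ℕ) {ι : Type*} [Fintype ι] (μ : Measure (Matrix ι ι ℂ))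
    (X : Matrix (Fin k → ι) (Fin k → ι) ℂ) : Matrix (Fin k → ι) (Fin k → ι) ℂ :=
  Matrix.of fun P Q => ∫ U, ((tpow k U) * X * (tpow k U)ᴴ) P Q ∂μ

/-- The projector `|EPR⟩⟨EPR|` onto the maximally entangled state
`2^{-N/2} ∑_x e_x ⊗ e_x` of two copies of an `N`-qubit system. -/
def eprProj (N : ℕ) :
    Matrix ((Fin N → ZMod 2) × (Fin N → ZMod 2))
      ((Fin N → ZMod 2) × (Fin N → ZMod 2)) ℂ :=
  Matrix.of fun p q =>
    ((2 : ℂ) ^ N)⁻¹ * (if p.1 = p.2 then 1 else 0) * (if q.1 = q.2 then 1 else 0)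

/-- The operator `U ⊗ I` on two copies of an `N`-qubit system. -/
def tensorWithId (N : ℕ)
    (U : Matrix (Fin N → ZMod 2) (Fin N → ZMod 2) ℂ) :
    Matrix ((Fin N → ZMod 2) × (Fin N → ZMod 2))
      ((Fin N → ZMod 2) × (Fin N → ZMod 2)) ℂ :=
  Matrix.of fun p q => U p.1 q.1 * (if p.2 = q.2 then 1 else 0)

section TensorPower

variable {k : ℕ} {β : Type*} [Fintype β]

/-- The bilinear pairing of a coefficient array with the `k`-fold tensor power of a matrix. -/
def tpowPairing (c : (Fin k → β) → (Fin k → β) → ℂ) (M : Matrix β β ℂ) : ℂ :=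
  ∑ x, ∑ y, c x y * tpow k M x y

open MvPolynomial in
theorem tpowPairing_mul_diagonal_mul [DecidableEq β] {c : (Fin k → β) → (Fin k → β) → ℂ}
    (hc : ∀ U ∈ unitaryGroup β ℂ, tpowPairing c U = 0)
    {V : Matrix β β ℂ} (hV : V ∈ unitaryGroup β ℂ) (t : β → ℂ) :
    tpowPairing c (V * diagonal t * star V) = 0 := by
  let F : MvPolynomial β ℂ := ∑ x, ∑ y, C (c x y) *
    ∏ a, ∑ b, C (V (x a) b * star (V (y a) b)) * X b
  have hF : ∀ s : β → ℂ, eval s F = tpowPairing c (V * diagonal s * star V) := by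
    intro s
    simp only [F, map_sum, map_mul, map_prod, eval_C, eval_X, tpowPairing, tpow, of_apply]
    refine Finset.sum_congr rfl fun x _ => Finset.sum_congr rfl fun y _ => ?_
    congr 1
    refine Finset.prod_congr rfl fun a _ => ?_
    rw [Matrix.mul_apply]
    simp only [mul_diagonal, star_apply]
    exact Finset.sum_congr rfl fun b _ => by ring
  have hF0 : F = 0 := by
    refine funext_set (fun _ => (Metric.sphere (0 : ℂ) 1)) (fun _ => ?_) fun s hs => ?_
    · refine Set.infinite_of_injOn_mapsTo (f := fun θ : ℝ => Complex.exp (θ * Complex.I))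
        (s := Set.Ioo 0 1) ?_ (fun θ _ => ?_) (Set.Ioo_infinite one_pos)
      · have harg : ∀ θ ∈ Set.Ioo (0 : ℝ) 1, (Complex.exp (θ * Complex.I)).arg = θ := by
          rintro θ ⟨h0, h1⟩
          have := Real.pi_gt_three
          rw [Complex.exp_mul_I, Complex.arg_cos_add_sin_mul_I ⟨by linarith, by linarith⟩]
        exact fun θ hθ φ hφ h => by rw [← harg θ hθ, ← harg φ hφ]; exact congrArg Complex.arg h
      · exact mem_sphere_zero_iff_norm.mpr (Complex.norm_exp_ofReal_mul_I θ)
    · rw [hF, map_zero]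
      refine hc _ (mul_mem (mul_mem hV ?_) (Unitary.star_mem hV))
      rw [mem_unitaryGroup_iff, star_eq_conjTranspose, diagonal_conjTranspose,
        diagonal_mul_diagonal, ← diagonal_one]
      congr 1
      ext b
      have h1 : ‖s b‖ = 1 := by simpa using hs b trivial
      simp [Complex.mul_conj, Complex.normSq_eq_norm_sq, h1]
  rw [← hF, hF0, map_zero]

theorem tpowPairing_of_isHermitian [DecidableEq β] {c : (Fin k → β) → (Fin k → β) → ℂ}
    (hc : ∀ U ∈ unitaryGroup β ℂ, tpowPairing c U = 0) {H : Matrix β β ℂ}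
    (hH : H.IsHermitian) : tpowPairing c H = 0 := by
  rw [hH.spectral_theorem, Unitary.conjStarAlgAut_apply]
  exact tpowPairing_mul_diagonal_mul hc hH.eigenvectorUnitary.2 _

open Polynomial in
theorem tpowPairing_eq_zero [DecidableEq β] {c : (Fin k → β) → (Fin k → β) → ℂ}
    (hc : ∀ U ∈ unitaryGroup β ℂ, tpowPairing c U = 0) (M : Matrix β β ℂ) :
    tpowPairing c M = 0 := by
  let H₁ : Matrix β β ℂ := (realPart M : Matrix β β ℂ)
  let H₂ : Matrix β β ℂ := (imaginaryPart M : Matrix β β ℂ)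
  let F : ℂ[X] := ∑ x, ∑ y, C (c x y) * ∏ a, (C (H₁ (x a) (y a)) + C (H₂ (x a) (y a)) * X)
  have hF : ∀ z : ℂ, F.eval z = tpowPairing c (H₁ + z • H₂) := by
    intro z
    simp only [F, eval_finsetSum, eval_mul, eval_prod, eval_add, eval_C, eval_X, tpowPairing,
      tpow, of_apply, Matrix.add_apply, Matrix.smul_apply, smul_eq_mul, mul_comm z]
  have hF0 : F = 0 := by
    refine eq_zero_of_infinite_isRoot F
      ((Set.infinite_range_of_injective Complex.ofReal_injective).mono ?_)
    rintro _ ⟨r, rfl⟩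
    rw [Set.mem_ofPred_eq, IsRoot.def, hF]
    refine tpowPairing_of_isHermitian hc ?_
    have h₁ : star H₁ = H₁ := (realPart M).2
    have h₂ : star H₂ = H₂ := (imaginaryPart M).2
    rw [Matrix.IsHermitian, ← star_eq_conjTranspose, star_add, star_smul, h₁, h₂]
    simp
  have := hF Complex.I
  rw [hF0, eval_zero, realPart_add_I_smul_imaginaryPart] at this
  exact this.symm

open MvPolynomial in
/-- Polarization: a functional that vanishes on `U^{⊗k}` for all unitary `U` vanishes on all
symmetrized products of matrix units. -/
theorem sum_perm_eq_zero_of_tpowPairing [DecidableEq β] {c : (Fin k → β) → (Fin k → β) → ℂ}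
    (hc : ∀ U ∈ unitaryGroup β ℂ, tpowPairing c U = 0) (p q : Fin k → β) :
    ∑ π : Equiv.Perm (Fin k), c (p ∘ π) (q ∘ π) = 0 := by
  let F : MvPolynomial (Fin k) ℂ := ∑ x, ∑ y, C (c x y) *
    ∏ a, ∑ b, C (if x a = p b ∧ y a = q b then (1 : ℂ) else 0) * X b
  have hF0 : F = 0 := by
    refine MvPolynomial.funext fun s => ?_
    rw [map_zero, ← tpowPairing_eq_zero hc
      (Matrix.of fun i j => ∑ b, (if i = p b ∧ j = q b then (1 : ℂ) else 0) * s b)]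
    simp only [F, map_sum, map_mul, map_prod, eval_C, eval_X, tpowPairing, tpow, of_apply]
  have hF : F = ∑ f : Fin k → Fin k, C (c (p ∘ f) (q ∘ f)) * ∏ a, X (f a) := by
    simp only [F, Finset.prod_univ_sum, Fintype.piFinset_univ, Finset.prod_mul_distrib,
      Finset.mul_sum, ← map_prod]
    simp_rw [Finset.sum_comm (s := (Finset.univ : Finset (Fin k → β)))
      (t := (Finset.univ : Finset (Fin k → Fin k)))]
    refine Finset.sum_congr rfl fun f _ => ?_
    rw [Finset.sum_eq_single (p ∘ f), Finset.sum_eq_single (q ∘ f)]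
    · simp
    · intro y _ hy
      obtain ⟨a, ha⟩ := Function.ne_iff.mp hy
      rw [Finset.prod_eq_zero (Finset.mem_univ a)]
      · simp
      · exact if_neg fun h => ha h.2
    · simp
    · intro x _ hx
      obtain ⟨a, ha⟩ := Function.ne_iff.mp hx
      refine Finset.sum_eq_zero fun y _ => ?_
      rw [Finset.prod_eq_zero (Finset.mem_univ a)]
      · simp
      · exact if_neg fun h => ha h.1
    · simp
  have hX : ∀ f : Fin k → Fin k, (∏ a, X (f a) : MvPolynomial (Fin k) ℂ) =
      monomial (∑ a, Finsupp.single (f a) 1) 1 := fun f => by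
    rw [monomial_sum_one]
    rfl
  have hbij : ∀ f : Fin k → Fin k, (∑ a, Finsupp.single (f a) 1 : Fin k →₀ ℕ) =
      ∑ a, Finsupp.single a 1 ↔ Function.Bijective f := by
    intro f
    constructor
    · intro h
      refine Finite.surjective_iff_bijective.mp fun b => ?_
      have hb := DFunLike.congr_fun h b
      simp only [Finsupp.finsetSum_apply, Finsupp.single_apply] at hb
      by_contra! hne
      simp [hne] at hb
    · intro h
      exact h.sum_comp (fun a => Finsupp.single a 1)
  have key := congrArg (coeff (∑ a, Finsupp.single a 1)) hF
  simp only [hF0, coeff_zero, hX, coeff_sum, coeff_C_mul, coeff_monomial, hbij, mul_ite, mul_one,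
    mul_zero] at key
  rw [← Finset.sum_filter] at key
  rw [key]
  refine Finset.sum_bij (fun π _ => ⇑π)
    (fun π _ => Finset.mem_filter.mpr ⟨Finset.mem_univ _, π.bijective⟩)
    (fun _ _ _ _ h => DFunLike.coe_injective h)
    (fun f hf => ⟨Equiv.ofBijective f (by simpa using hf), Finset.mem_univ _, rfl⟩)
    fun _ _ => rfl

end TensorPower

section Permutations

open scoped MatrixOrder Kronecker

variable {k : ℕ} {β : Type*}

theorem permMat_apply (π : Equiv.Perm (Fin k)) (X Y : Fin k → β) :
    permMat k β π X Y = if X = Y ∘ π then 1 else 0 := by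
  simp [permMat, funext_iff]

theorem permMat_one [DecidableEq β] : permMat k β 1 = 1 := by
  ext X Y
  simp [permMat_apply, Matrix.one_apply]

/-- The permutations of the tensor factors fixing a basis vector of `(ℂ^β)^{⊗k}`. -/
def fiberSubgroup (y : Fin k → β) : Subgroup (Equiv.Perm (Fin k)) where
  carrier := {π | y ∘ π = y}
  mul_mem' {π σ} hπ hσ := by
    change y ∘ π ∘ σ = y
    rw [← Function.comp_assoc, show y ∘ π = y from hπ, show y ∘ σ = y from hσ]
  one_mem' := rfl
  inv_mem' {π} hπ := by
    change y ∘ (π⁻¹ : Equiv.Perm (Fin k)) = y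
    nth_rw 1 [← show y ∘ π = y from hπ]
    ext a
    simp

theorem mem_fiberSubgroup {y : Fin k → β} {π : Equiv.Perm (Fin k)} :
    π ∈ fiberSubgroup y ↔ y ∘ π = y := Iff.rfl

theorem fiberSubgroup_eq_bot {y : Fin k → β} (hy : Function.Injective y) :
    fiberSubgroup y = ⊥ := by
  refine (Subgroup.eq_bot_iff_forall _).mpr fun π hπ => ?_
  ext a
  exact congrArg _ (hy (congrFun (mem_fiberSubgroup.mp hπ) a))

theorem conjTranspose_permMat (π : Equiv.Perm (Fin k)) :
    (permMat k β π)ᴴ = permMat k β π⁻¹ := by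
  ext X Y
  simp only [conjTranspose_apply, permMat_apply, apply_ite star, star_one, star_zero]
  refine if_congr ⟨?_, ?_⟩ rfl rfl <;> rintro rfl <;> ext a <;> simp

/-- The sum of the factor permutations in a subgroup, i.e. the order of the subgroup times the
projection onto its invariants. -/
def subgroupSum (β : Type*) (H : Subgroup (Equiv.Perm (Fin k))) :
    Matrix (Fin k → β) (Fin k → β) ℂ :=
  ∑ π : H, permMat k β π

theorem isHermitian_subgroupSum (H : Subgroup (Equiv.Perm (Fin k))) :
    (subgroupSum β H).IsHermitian := by
  rw [Matrix.IsHermitian, subgroupSum, conjTranspose_sum]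
  simp_rw [conjTranspose_permMat]
  exact Equiv.sum_comp (Equiv.inv H) (fun π : H => permMat k β (π : Equiv.Perm (Fin k)))

variable [Fintype β]

theorem permMat_mul (π σ : Equiv.Perm (Fin k)) :
    permMat k β π * permMat k β σ = permMat k β (σ * π) := by
  ext X Y
  simp only [Matrix.mul_apply, permMat_apply, Equiv.Perm.coe_mul, ← Function.comp_assoc]
  rw [Finset.sum_eq_single (Y ∘ σ) (by simp +contextual) (by simp), if_pos rfl, mul_one]
  congr

theorem subgroupSum_mul_self (H : Subgroup (Equiv.Perm (Fin k))) :
    subgroupSum β H * subgroupSum β H = (Fintype.card H : ℂ) • subgroupSum β H := by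
  simp only [subgroupSum, Finset.mul_sum, Finset.sum_mul, permMat_mul]
  have h : ∀ σ : H, ∑ π : H, permMat k β ((σ : Equiv.Perm (Fin k)) * π) =
      ∑ π : H, permMat k β (π : Equiv.Perm (Fin k)) := fun σ =>
    Equiv.sum_comp (Equiv.mulLeft σ) (fun π : H => permMat k β (π : Equiv.Perm (Fin k)))
  simp_rw [h]
  simp [Nat.cast_smul_eq_nsmul]

theorem subgroupSum_nonneg (H : Subgroup (Equiv.Perm (Fin k))) : 0 ≤ subgroupSum β H := by
  rw [nonneg_iff_posSemidef]
  have h0 : (Fintype.card H : ℂ) ≠ 0 := by simp [Fintype.card_ne_zero]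
  have h : subgroupSum β H = (Fintype.card H : ℂ)⁻¹ • ((subgroupSum β H)ᴴ * subgroupSum β H) := by
    rw [(isHermitian_subgroupSum H).eq, subgroupSum_mul_self, smul_smul, inv_mul_cancel₀ h0,
      one_smul]
  rw [h]
  exact (posSemidef_conjTranspose_mul_self _).smul (by positivity)

theorem subgroupSum_le [DecidableEq β] (H : Subgroup (Equiv.Perm (Fin k))) :
    subgroupSum β H ≤ (Fintype.card H : ℂ) • 1 := by
  rw [Matrix.le_iff]
  set S := subgroupSum β H with hS
  set m := (Fintype.card H : ℂ) with hm
  have h0 : m ≠ 0 := by simp [hm, Fintype.card_ne_zero]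
  have hS2 : S * S = m • S := subgroupSum_mul_self H
  have hD : (m • 1 - S)ᴴ = m • 1 - S := by
    rw [conjTranspose_sub, conjTranspose_smul, conjTranspose_one,
      (isHermitian_subgroupSum H).eq, hm, star_natCast]
  have h : m • 1 - S = m⁻¹ • ((m • 1 - S)ᴴ * (m • 1 - S)) := by
    rw [hD]
    simp only [sub_mul, mul_sub, hS2, smul_mul_assoc, mul_smul_comm, one_mul, mul_one, sub_self,
      sub_zero]
    rw [smul_smul, inv_mul_cancel₀ h0, one_smul]
  rw [h]
  exact (posSemidef_conjTranspose_mul_self _).smul (by rw [hm]; positivity)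

/-- The partial trace over the second copy of `∑_π R(π) ⊗ R(π)`, i.e. `∑_π Tr R(π) • R(π)`. -/
def permGram (k : ℕ) (β : Type*) [Fintype β] : Matrix (Fin k → β) (Fin k → β) ℂ :=
  ∑ y : Fin k → β, subgroupSum β (fiberSubgroup y)

theorem permGram_apply (x x' : Fin k → β) :
    permGram k β x x' = ∑ y : Fin k → β, ∑ π : Equiv.Perm (Fin k),
      if y ∘ π = y then (if x = x' ∘ π then (1 : ℂ) else 0) else 0 := by
  simp only [permGram, subgroupSum, Matrix.sum_apply, permMat_apply]
  refine Finset.sum_congr rfl fun y _ => ?_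
  refine Eq.trans ?_ (Finset.sum_filter _ _)
  exact (Finset.sum_subtype (p := (· ∈ fiberSubgroup y)) (Finset.univ.filter fun π => y ∘ ⇑π = y)
    (by simp [mem_fiberSubgroup])
    (fun π : Equiv.Perm (Fin k) => if x = x' ∘ π then (1 : ℂ) else 0)).symm

theorem card_fiberSubgroup [DecidableEq β] (y : Fin k → β) :
    Fintype.card (fiberSubgroup y) = ∏ b, (Fintype.card {a // y a = b}).factorial := by
  rw [← DomMulAct.stabilizer_card y]
  exact Fintype.card_congr (Equiv.refl _)

theorem sum_card_fiberSubgroup (k : ℕ) (β : Type*) [Fintype β] :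
    ∑ y : Fin k → β, Fintype.card (fiberSubgroup y) =
      ∏ i ∈ Finset.range k, (Fintype.card β + i) := by
  simp_rw [card_fiberSubgroup]
  induction k with
  | zero => simp
  | succ k ih =>
    rw [Finset.prod_range_succ, ← ih, Finset.sum_mul, ← (Fin.consEquiv fun _ => β).sum_comp,
      Fintype.sum_prod_type_right]
    refine Finset.sum_congr rfl fun y _ => ?_
    have hcard : ∀ b c : β,
        Fintype.card {a : Fin (k + 1) // (Fin.cons b y : Fin (k + 1) → β) a = c} =
        Fintype.card {a // y a = c} + if b = c then 1 else 0 := by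
      intro b c
      simp only [Fintype.card_subtype, Finset.card_filter, Fin.sum_univ_succ, Fin.cons_zero,
        Fin.cons_succ, add_comm]
    have hprod : ∀ b : β, ∏ c, (Fintype.card {a : Fin (k + 1) //
        (Fin.cons b y : Fin (k + 1) → β) a = c}).factorial =
        (∏ c, (Fintype.card {a // y a = c}).factorial) * (Fintype.card {a // y a = b} + 1) := by
      intro b
      simp_rw [hcard]
      rw [← Finset.mul_prod_erase _ _ (Finset.mem_univ b),
        ← Finset.mul_prod_erase (a := b) _ (fun c => (Fintype.card {a // y a = c}).factorial)
          (Finset.mem_univ b), if_pos rfl, Nat.factorial_succ]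
      rw [Finset.prod_congr rfl fun c hc => by
        rw [if_neg (Finset.ne_of_mem_erase hc).symm, add_zero]]
      ring
    have hsum : ∑ b, Fintype.card {a // y a = b} = k := by
      rw [← Fintype.card_sigma]
      simpa using Fintype.card_congr (Equiv.sigmaFiberEquiv y)
    refine (Finset.sum_congr rfl fun b _ => hprod b).trans ?_
    rw [← Finset.mul_sum, Finset.sum_add_distrib, hsum]
    simp [add_comm]

theorem permGram_le (k : ℕ) (β : Type*) [Fintype β] [DecidableEq β] :
    permGram k β ≤ (∏ i ∈ Finset.range k, ((Fintype.card β : ℂ) + i)) • 1 := by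
  have h : (∏ i ∈ Finset.range k, ((Fintype.card β : ℂ) + i)) =
      ∑ y : Fin k → β, (Fintype.card (fiberSubgroup y) : ℂ) := by
    rw [← Nat.cast_sum, sum_card_fiberSubgroup]
    push_cast
    rfl
  rw [h, Finset.sum_smul]
  exact Finset.sum_le_sum fun y _ => subgroupSum_le _

theorem le_permGram (k : ℕ) (β : Type*) [Fintype β] [DecidableEq β] :
    ((Fintype.card β).descFactorial k : ℂ) • (1 : Matrix (Fin k → β) (Fin k → β) ℂ) ≤
      permGram k β := by
  have h1 : ∀ y : Fin k → β, Function.Injective y → subgroupSum β (fiberSubgroup y) = 1 := by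
    intro y hy
    rw [subgroupSum, Fintype.sum_eq_single 1 fun π hπ => (hπ (Subtype.ext
      ((Subgroup.eq_bot_iff_forall _).mp (fiberSubgroup_eq_bot hy) π π.2))).elim]
    exact permMat_one
  have hcard : (Finset.univ.filter fun y : Fin k → β => Function.Injective y).card =
      (Fintype.card β).descFactorial k := by
    rw [← Fintype.card_subtype, Fintype.card_congr (Equiv.subtypeInjectiveEquivEmbedding _ _),
      Fintype.card_embedding_eq, Fintype.card_fin]
  calc _ = ∑ y : Fin k → β with Function.Injective y, subgroupSum β (fiberSubgroup y) := by
        rw [Finset.sum_congr rfl fun y hy => h1 y (Finset.mem_filter.mp hy).2, Finset.sum_const,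
          hcard, Nat.cast_smul_eq_nsmul]
    _ ≤ permGram k β := Finset.sum_le_univ_sum_of_nonneg fun y => subgroupSum_nonneg _

theorem mul_kronecker_one_nonneg {m n : Type*} [Fintype m] [Fintype n]
    [DecidableEq m] [DecidableEq n]
    {T : Matrix (m × n) (m × n) ℂ} {B : Matrix m m ℂ} (hT : 0 ≤ T) (hB : 0 ≤ B)
    (h : Commute T (B ⊗ₖ (1 : Matrix n n ℂ))) : 0 ≤ T * (B ⊗ₖ (1 : Matrix n n ℂ)) := by
  have hB' : 0 ≤ B ⊗ₖ (1 : Matrix n n ℂ) :=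
    nonneg_iff_posSemidef.mpr ((nonneg_iff_posSemidef.mp hB).kronecker .one)
  open scoped Matrix.Norms.L2Operator in exact h.mul_nonneg hT hB'

end Permutations

section Moments

open scoped MatrixOrder Kronecker

theorem tpow_mul {k : ℕ} {β : Type*} [Fintype β] (M M' : Matrix β β ℂ) :
    tpow k (M * M') = tpow k M * tpow k M' := by
  ext X Y
  simp only [tpow, of_apply, Matrix.mul_apply, Finset.prod_univ_sum, Fintype.piFinset_univ,
    Finset.prod_mul_distrib]

theorem tpow_one {k : ℕ} {β : Type*} [DecidableEq β] : tpow k (1 : Matrix β β ℂ) = 1 := by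
  ext X Y
  by_cases h : X = Y
  · subst h
    rw [Matrix.one_apply_eq, tpow, of_apply]
    exact Finset.prod_eq_one fun a _ => Matrix.one_apply_eq (α := ℂ) (X a)
  · obtain ⟨a, ha⟩ := Function.ne_iff.mp h
    rw [Matrix.one_apply_ne h]
    exact Finset.prod_eq_zero (Finset.mem_univ a) (Matrix.one_apply_ne ha)

theorem conjTranspose_tpow {k : ℕ} {β : Type*} (M : Matrix β β ℂ) :
    (tpow k M)ᴴ = tpow k Mᴴ := by
  ext X Y
  simp [tpow, conjTranspose_apply]

theorem tpow_comp_perm {k : ℕ} {β : Type*} (M : Matrix β β ℂ) (X Y : Fin k → β)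
    (π : Equiv.Perm (Fin k)) : tpow k M (X ∘ π) (Y ∘ π) = tpow k M X Y :=
  Equiv.prod_comp π fun a => M (X a) (Y a)

theorem measurable_matrix_entry {β : Type*} (i j : β) : Measurable fun U : Matrix β β ℂ => U i j :=
  (measurable_pi_apply j).comp (measurable_pi_apply i)

theorem measurable_tpow_entry {k : ℕ} {β : Type*} (X Y : Fin k → β) :
    Measurable fun U : Matrix β β ℂ => tpow k U X Y := by
  simp only [tpow, of_apply]
  exact Finset.measurable_prod _ fun a _ => measurable_matrix_entry (X a) (Y a)

theorem measurable_matrix_mul_left {β : Type*} [Fintype β] (V : Matrix β β ℂ) :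
    Measurable fun U : Matrix β β ℂ => V * U := by
  refine measurable_pi_lambda _ fun i => measurable_pi_lambda _ fun j => ?_
  exact Finset.measurable_sum _ fun l _ => (measurable_matrix_entry l j).const_mul (V i l)

/-- The matrix `∑_π R(π) ⊗ R(π)`. -/
def permSum (k : ℕ) (β : Type*) :
    Matrix ((Fin k → β) × (Fin k → β)) ((Fin k → β) × (Fin k → β)) ℂ :=
  Matrix.of fun p q => ∑ π : Equiv.Perm (Fin k),
    if p.1 = q.1 ∘ π then (if p.2 = q.2 ∘ π then (1 : ℂ) else 0) else 0

theorem conjTranspose_permSum (k : ℕ) (β : Type*) : (permSum k β)ᴴ = permSum k β := by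
  ext ⟨x, y⟩ ⟨x', y'⟩
  simp only [permSum, conjTranspose_apply, of_apply, star_sum, apply_ite star, star_one,
    star_zero]
  refine Fintype.sum_equiv (Equiv.inv _) _ _ fun π => ?_
  have h : ∀ u v : Fin k → β, u = v ∘ π ↔ v = u ∘ (π⁻¹ : Equiv.Perm (Fin k)) := fun u v =>
    ⟨by rintro rfl; ext; simp, by rintro rfl; ext; simp⟩
  simp [h]

theorem sub_kronecker {m n : Type*} (A B : Matrix m m ℂ) (C : Matrix n n ℂ) :
    (A - B) ⊗ₖ C = A ⊗ₖ C - B ⊗ₖ C := by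
  ext
  exact sub_mul _ _ _

variable {k : ℕ} {β : Type*} [Fintype β] [DecidableEq β]

theorem conjTranspose_tpow_mul_tpow {U : Matrix β β ℂ} (hU : U ∈ UnitarySet β) :
    (tpow k U)ᴴ * tpow k U = 1 := by
  rw [conjTranspose_tpow, ← tpow_mul, ← star_eq_conjTranspose, mem_unitaryGroup_iff'.mp hU,
    tpow_one]

theorem norm_tpow_le_one {U : Matrix β β ℂ} (hU : U ∈ UnitarySet β) (X Y : Fin k → β) :
    ‖tpow k U X Y‖ ≤ 1 := by
  rw [tpow, of_apply, norm_prod]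
  exact Finset.prod_le_one (fun _ _ => norm_nonneg _) fun a _ =>
    entry_norm_bound_of_unitary hU _ _

theorem measurableSet_unitarySet : MeasurableSet (UnitarySet β) := by
  have h : UnitarySet β = ⋂ i, ⋂ j, {U | (U * star U) i j = (1 : Matrix β β ℂ) i j} := by
    ext U
    simp only [UnitarySet, SetLike.mem_coe, mem_unitaryGroup_iff, Set.mem_iInter,
      Set.mem_ofPred_eq]
    exact Matrix.ext_iff.symm
  rw [h]
  refine MeasurableSet.iInter fun i => MeasurableSet.iInter fun j =>
    measurableSet_eq_fun (Finset.measurable_sum _ fun l _ => ?_) measurable_const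
  exact (measurable_matrix_entry i l).mul
    (continuous_star.measurable.comp (measurable_matrix_entry j l))

variable {μ : Measure (Matrix β β ℂ)}

theorem ae_mem_unitarySet [IsProbabilityMeasure μ] (hμ : μ (UnitarySet β) = 1) :
    ∀ᵐ U ∂μ, U ∈ UnitarySet β :=
  (mem_ae_iff_prob_eq_one measurableSet_unitarySet).mpr hμ

theorem integrable_tpow_mul_star [IsProbabilityMeasure μ] (hμ : μ (UnitarySet β) = 1)
    (X Y X' Y' : Fin k → β) :
    Integrable (fun U => tpow k U X Y * star (tpow k U X' Y')) μ := by
  refine Integrable.of_bound ((measurable_tpow_entry X Y).mul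
    (continuous_star.measurable.comp (measurable_tpow_entry X' Y'))).aestronglyMeasurable 1 ?_
  filter_upwards [ae_mem_unitarySet hμ] with U hU
  rw [norm_mul, norm_star]
  exact mul_le_one₀ (norm_tpow_le_one hU _ _) (norm_nonneg _) (norm_tpow_le_one hU _ _)

/-- The second moment `E[vec(U^{⊗k}) vec(U^{⊗k})†]`, i.e. the unnormalized Choi matrix of the
`k`-fold channel. -/
def choiMoment (k : ℕ) {β : Type*} (μ : Measure (Matrix β β ℂ)) :
    Matrix ((Fin k → β) × (Fin k → β)) ((Fin k → β) × (Fin k → β)) ℂ :=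
  Matrix.of fun p q => ∫ U, tpow k U p.1 p.2 * star (tpow k U q.1 q.2) ∂μ

theorem choiMoment_nonneg [IsProbabilityMeasure μ] (hμ : μ (UnitarySet β) = 1) :
    0 ≤ choiMoment k μ := by
  rw [nonneg_iff_posSemidef]
  refine .of_dotProduct_mulVec_nonneg ?_ fun x => ?_
  · ext p q
    rw [conjTranspose_apply, choiMoment, of_apply, of_apply, RCLike.star_def, ← integral_conj]
    simp [mul_comm]
  · have h : star x ⬝ᵥ (choiMoment k μ *ᵥ x) =
        ∫ U, ((‖∑ p : (Fin k → β) × (Fin k → β),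
          star (x p) * tpow k U p.1 p.2‖ ^ 2 : ℝ) : ℂ) ∂μ := by
      have hU : ∀ U : Matrix β β ℂ,
          ((‖∑ p : (Fin k → β) × (Fin k → β), star (x p) * tpow k U p.1 p.2‖ ^ 2 : ℝ) : ℂ) =
          ∑ p : (Fin k → β) × (Fin k → β), ∑ q : (Fin k → β) × (Fin k → β),
            star (x p) * x q * (tpow k U p.1 p.2 * star (tpow k U q.1 q.2)) := by
        intro U
        rw [Complex.ofReal_pow, ← Complex.mul_conj', ← RCLike.star_def, star_sum,
          Finset.sum_mul_sum]
        refine Finset.sum_congr rfl fun p _ => Finset.sum_congr rfl fun q _ => ?_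
        rw [star_mul', star_star]
        ring
      simp_rw [hU]
      rw [integral_finsetSum _ fun p _ => integrable_finsetSum _ fun q _ =>
        (integrable_tpow_mul_star hμ _ _ _ _).const_mul _]
      simp only [dotProduct, mulVec, Finset.mul_sum]
      refine Finset.sum_congr rfl fun p _ => ?_
      rw [integral_finsetSum _ fun q _ => (integrable_tpow_mul_star hμ _ _ _ _).const_mul _]
      refine Finset.sum_congr rfl fun q _ => ?_
      rw [integral_const_mul, choiMoment, of_apply, Pi.star_apply]
      ring
    rw [h, integral_complex_ofReal]
    exact Complex.zero_le_real.mpr (integral_nonneg fun U => by positivity)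

theorem choiMoment_covariant (hμ : IsHaarOn (UnitarySet β) μ) {V : Matrix β β ℂ}
    (hV : V ∈ UnitarySet β) (x y x' y' : Fin k → β) :
    ∑ z, tpow k V x z * choiMoment k μ (z, y) (x', y') =
      ∑ z, choiMoment k μ (x, y) (z, y') * tpow k V z x' := by
  obtain ⟨hP, hU, hinv⟩ := hμ
  have hr : ∑ z, choiMoment k μ (x, y) (z, y') * tpow k V z x' =
      ∫ U, tpow k U x y * star (((tpow k V)ᴴ * tpow k U) x' y') ∂μ := by
    simp only [Matrix.mul_apply, star_sum, star_mul', conjTranspose_apply, star_star,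
      Finset.mul_sum]
    simp only [choiMoment, of_apply, ← integral_mul_const]
    rw [← integral_finsetSum _ fun z _ => (integrable_tpow_mul_star hU _ _ _ _).mul_const _]
    refine integral_congr_ae (.of_forall fun U => Finset.sum_congr rfl fun z _ => ?_)
    ring
  have hmeas : Measurable fun U : Matrix β β ℂ =>
      tpow k U x y * star (((tpow k V)ᴴ * tpow k U) x' y') := by
    refine (measurable_tpow_entry x y).mul (continuous_star.measurable.comp ?_)
    exact Finset.measurable_sum _ fun z _ => (measurable_tpow_entry z y').const_mul _
  rw [hr, ← hinv V hV, integral_map (measurable_matrix_mul_left V).aemeasurable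
    hmeas.aestronglyMeasurable]
  simp only [tpow_mul, ← Matrix.mul_assoc, conjTranspose_tpow_mul_tpow hV, Matrix.one_mul]
  simp only [hinv V hV, choiMoment, of_apply, ← integral_const_mul]
  rw [← integral_finsetSum _ fun z _ => (integrable_tpow_mul_star hU _ _ _ _).const_mul _]
  refine integral_congr_ae (.of_forall fun U => ?_)
  simp only [Matrix.mul_apply, Finset.sum_mul]
  exact Finset.sum_congr rfl fun z _ => by ring

theorem choiMoment_sum_perm (hμ : IsHaarOn (UnitarySet β) μ) (x y x' y' p q : Fin k → β) :
    ∑ π : Equiv.Perm (Fin k), (if p ∘ π = x then choiMoment k μ (q ∘ π, y) (x', y') else 0) =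
      ∑ π : Equiv.Perm (Fin k), (if q ∘ π = x' then choiMoment k μ (x, y) (p ∘ π, y') else 0) := by
  rw [← sub_eq_zero, ← Finset.sum_sub_distrib]
  refine sum_perm_eq_zero_of_tpowPairing (c := fun u v =>
    (if u = x then choiMoment k μ (v, y) (x', y') else 0) -
      if v = x' then choiMoment k μ (x, y) (u, y') else 0) (fun V hV => ?_) p q
  simp only [tpowPairing, sub_mul, Finset.sum_sub_distrib, ite_mul, zero_mul,
    Finset.sum_ite_eq', Finset.mem_univ, if_true]
  rw [Finset.sum_comm]
  simp only [Finset.sum_ite_eq', Finset.mem_univ, if_true]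
  rw [sub_eq_zero, ← choiMoment_covariant hμ hV]
  exact Finset.sum_congr rfl fun z _ => mul_comm _ _

theorem sum_choiMoment [IsProbabilityMeasure μ] (hμ : μ (UnitarySet β) = 1) (y y' : Fin k → β)
    (π : Equiv.Perm (Fin k)) :
    ∑ q : Fin k → β, choiMoment k μ (q ∘ π, y) (q, y') = if y = y' ∘ π then 1 else 0 := by
  simp only [choiMoment, of_apply]
  rw [← integral_finsetSum _ fun z _ => integrable_tpow_mul_star hμ _ _ _ _]
  have h : (fun U => ∑ q : Fin k → β, tpow k U (q ∘ π) y * star (tpow k U q y')) =ᵐ[μ]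
      fun _ => if y = y' ∘ π then 1 else 0 := by
    filter_upwards [ae_mem_unitarySet hμ] with U hU
    have h1 := congrFun (congrFun (conjTranspose_tpow_mul_tpow (k := k) hU) (y' ∘ π)) y
    rw [Matrix.mul_apply, Matrix.one_apply] at h1
    rw [if_congr eq_comm rfl rfl, ← h1,
      ← Equiv.sum_comp (Equiv.arrowCongr π (Equiv.refl β))]
    refine Finset.sum_congr rfl fun q _ => ?_
    have hq : Equiv.arrowCongr π (Equiv.refl β) q ∘ π = q := by
      ext a
      simp
    rw [mul_comm, conjTranspose_apply, ← tpow_comp_perm U _ y' π, hq]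
  rw [integral_congr_ae h]
  simp

theorem choiMoment_mul_permGram (hμ : IsHaarOn (UnitarySet β) μ) :
    choiMoment k μ * (permGram k β ⊗ₖ (1 : Matrix (Fin k → β) (Fin k → β) ℂ)) = permSum k β := by
  ext ⟨x, y⟩ ⟨x', y'⟩
  have := hμ.1
  rw [Matrix.mul_apply, Fintype.sum_prod_type]
  simp only [kronecker_apply, Matrix.one_apply, mul_ite, mul_one, mul_zero, Finset.sum_ite_eq',
    Finset.mem_univ, if_true]
  simp only [permGram_apply, Finset.mul_sum]
  rw [Finset.sum_comm]
  have h : ∀ q : Fin k → β, ∑ p : Fin k → β, ∑ π : Equiv.Perm (Fin k),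
      choiMoment k μ (x, y) (p, y') *
        (if q ∘ π = q then (if p = x' ∘ π then (1 : ℂ) else 0) else 0) =
      ∑ π : Equiv.Perm (Fin k), if x' ∘ π = x then choiMoment k μ (q ∘ π, y) (q, y') else 0 := by
    intro q
    rw [choiMoment_sum_perm hμ, Finset.sum_comm]
    refine Finset.sum_congr rfl fun π _ => ?_
    split_ifs <;> simp
  refine (Finset.sum_congr rfl fun q _ => by convert h q).trans ?_
  rw [Finset.sum_comm, permSum, of_apply]
  refine Finset.sum_congr rfl fun π _ => ?_
  by_cases hx : x = x' ∘ π
  · simp only [if_pos hx, if_pos hx.symm]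
    convert sum_choiMoment hμ.2.1 y y' π
  · simp only [if_neg hx, if_neg (Ne.symm hx), Finset.sum_const_zero]

theorem commute_choiMoment_permGram (hμ : IsHaarOn (UnitarySet β) μ) :
    Commute (choiMoment k μ) (permGram k β ⊗ₖ (1 : Matrix (Fin k → β) (Fin k → β) ℂ)) := by
  have := hμ.1
  have hT : (choiMoment k μ)ᴴ = choiMoment k μ :=
    (nonneg_iff_posSemidef.mp (choiMoment_nonneg hμ.2.1)).isHermitian
  have hC : (permGram k β)ᴴ = permGram k β := by
    rw [permGram, conjTranspose_sum]
    exact Finset.sum_congr rfl fun y _ => isHermitian_subgroupSum _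
  rw [Commute, SemiconjBy]
  conv_lhs => rw [choiMoment_mul_permGram hμ, ← conjTranspose_permSum k β,
    ← choiMoment_mul_permGram hμ, conjTranspose_mul, conjTranspose_kronecker, hT, hC,
    conjTranspose_one]

theorem smul_choiMoment_le_permSum (hμ : IsHaarOn (UnitarySet β) μ) :
    ((Fintype.card β).descFactorial k : ℂ) • choiMoment k μ ≤ permSum k β := by
  have := hμ.1
  have h := mul_kronecker_one_nonneg (n := Fin k → β) (choiMoment_nonneg hμ.2.1)
    (sub_nonneg.mpr (le_permGram k β))
    (by
      rw [sub_kronecker, smul_kronecker, one_kronecker_one]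
      exact (commute_choiMoment_permGram hμ).sub_right ((Commute.one_right _).smul_right _))
  rw [sub_kronecker, smul_kronecker, one_kronecker_one, mul_sub, choiMoment_mul_permGram hμ,
    mul_smul_comm, mul_one] at h
  exact sub_nonneg.mp h

theorem permSum_le_smul_choiMoment (hμ : IsHaarOn (UnitarySet β) μ) :
    permSum k β ≤ (∏ i ∈ Finset.range k, ((Fintype.card β : ℂ) + i)) • choiMoment k μ := by
  have := hμ.1
  have h := mul_kronecker_one_nonneg (n := Fin k → β) (choiMoment_nonneg hμ.2.1)
    (sub_nonneg.mpr (permGram_le k β))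
    (by
      rw [sub_kronecker, smul_kronecker, one_kronecker_one]
      exact ((Commute.one_right _).smul_right _).sub_right (commute_choiMoment_permGram hμ))
  rw [sub_kronecker, smul_kronecker, one_kronecker_one, mul_sub, choiMoment_mul_permGram hμ,
    mul_smul_comm, mul_one] at h
  exact sub_nonneg.mp h

end Moments

section RelativeError

open scoped MatrixOrder

theorem mul_ascFactorial_le (n : ℕ) {j : ℕ} (hj : j ^ 2 ≤ n) :
    n * n.ascFactorial j ≤ n ^ j * (n + j ^ 2) := by
  induction j with
  | zero => simp
  | succ j ih =>
    have h : (n + j ^ 2) * (n + j) ≤ n * (n + (j + 1) ^ 2) := by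
      nlinarith [Nat.mul_le_mul_left (j + 1) hj]
    calc n * n.ascFactorial (j + 1) = n * n.ascFactorial j * (n + j) := by
          rw [Nat.ascFactorial_succ]; ring
      _ ≤ n ^ j * (n + j ^ 2) * (n + j) := Nat.mul_le_mul_right _ (ih (by nlinarith))
      _ = n ^ j * ((n + j ^ 2) * (n + j)) := mul_assoc _ _ _
      _ ≤ n ^ j * (n * (n + (j + 1) ^ 2)) := Nat.mul_le_mul_left _ h
      _ = n ^ (j + 1) * (n + (j + 1) ^ 2) := by ring

theorem pow_succ_le_mul_descFactorial (n : ℕ) {j : ℕ} (hj : j ^ 2 ≤ n) :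
    n ^ (j + 1) ≤ (n + j ^ 2) * n.descFactorial j := by
  induction j with
  | zero => simp
  | succ j ih =>
    obtain ⟨m, rfl⟩ : ∃ m, n = j + m := Nat.exists_eq_add_of_le (by nlinarith)
    have h : (j + m) * (j + m + j ^ 2) ≤ (j + m + (j + 1) ^ 2) * m := by
      nlinarith [Nat.mul_le_mul_left (j + 1) hj]
    calc (j + m) ^ (j + 1 + 1) = (j + m) * (j + m) ^ (j + 1) := by ring
      _ ≤ (j + m) * ((j + m + j ^ 2) * (j + m).descFactorial j) :=
          Nat.mul_le_mul_left _ (ih (by nlinarith))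
      _ = (j + m) * (j + m + j ^ 2) * (j + m).descFactorial j := (mul_assoc _ _ _).symm
      _ ≤ (j + m + (j + 1) ^ 2) * m * (j + m).descFactorial j := Nat.mul_le_mul_right _ h
      _ = _ := by rw [Nat.descFactorial_succ, Nat.add_sub_cancel_left, mul_assoc]

theorem posSemidef_choi {n : Type*} [Fintype n] [DecidableEq n] {Φ : Matrix n n ℂ → Matrix n n ℂ}
    (hΦ : CompletelyPositive Φ) :
    (Matrix.of fun p q : n × n => Φ (Matrix.single p.2 q.2 1) p.1 q.1).PosSemidef := by
  have h := hΦ _ (posSemidef_vecMulVec_self_star fun p : n × n => if p.1 = p.2 then (1 : ℂ) else 0)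
  convert h using 1
  ext p q
  simp only [tensorId, of_apply]
  congr 1
  ext a c
  by_cases ha : a = p.2 <;> by_cases hc : c = q.2 <;>
    simp [vecMulVec_apply, ha, hc, Ne.symm]

variable {k : ℕ} {β : Type*} [Fintype β] [DecidableEq β]

theorem kfold_single (μ : Measure (Matrix β β ℂ)) (x y x' y' : Fin k → β) :
    kfold k μ (Matrix.single y y' 1) x x' = choiMoment k μ (x, y) (x', y') := by
  simp [kfold, choiMoment, Matrix.mul_apply, Matrix.single_apply, ite_and, conjTranspose_apply]

/-- Reading a basis vector of `(ℂ^β ⊗ ℂ^β)^{⊗k}` as one of `(ℂ^β)^{⊗k} ⊗ (ℂ^β)^{⊗k}`. -/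
def unzip {k : ℕ} {β : Type*} (X : Fin k → β × β) : (Fin k → β) × (Fin k → β) :=
  (Prod.fst ∘ X, Prod.snd ∘ X)

theorem rhoHaar_prod (k : ℕ) (β : Type*) [Fintype β] :
    rhoHaar k (β × β) =
      (((Fintype.card β ^ 2).ascFactorial k : ℂ))⁻¹ • (permSum k β).submatrix unzip unzip := by
  rw [rhoHaar, Psym, smul_smul, ← _root_.mul_inv_rev, ← Nat.cast_mul, Fintype.card_prod, ← sq,
    ← Nat.ascFactorial_eq_factorial_mul_choose']
  congr 1
  ext X Y
  simp only [Matrix.sum_apply, submatrix_apply, permSum, of_apply, permMat_apply, unzip]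
  refine Finset.sum_congr rfl fun π _ => ?_
  have h : X = Y ∘ π ↔ Prod.fst ∘ X = (Prod.fst ∘ Y) ∘ π ∧ Prod.snd ∘ X = (Prod.snd ∘ Y) ∘ π := by
    simp [funext_iff, Prod.ext_iff, forall_and]
  by_cases h1 : Prod.fst ∘ X = (Prod.fst ∘ Y) ∘ π <;>
    by_cases h2 : Prod.snd ∘ X = (Prod.snd ∘ Y) ∘ π <;> simp [h, h1, h2]

theorem tpow_choi (N : ℕ) (U : Matrix (Fin N → ZMod 2) (Fin N → ZMod 2) ℂ)
    (X Y : Fin k → (Fin N → ZMod 2) × (Fin N → ZMod 2)) :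
    tpow k (tensorWithId N U * eprProj N * (tensorWithId N U)ᴴ) X Y =
      (((2 : ℂ) ^ N) ^ k)⁻¹ *
        (tpow k U (unzip X).1 (unzip X).2 * star (tpow k U (unzip Y).1 (unzip Y).2)) := by
  have h : ∀ p q, (tensorWithId N U * eprProj N * (tensorWithId N U)ᴴ) p q =
      ((2 : ℂ) ^ N)⁻¹ * (U p.1 p.2 * star (U q.1 q.2)) := by
    intro p q
    simp [Matrix.mul_apply, tensorWithId, eprProj, conjTranspose_apply, Fintype.sum_prod_type,
      apply_ite (starRingEnd ℂ)]
    ring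
  simp [tpow, h, Finset.prod_mul_distrib, unzip]

theorem matrix_smul_le_smul {n : Type*} [Fintype n] {A B : Matrix n n ℂ} (h : A ≤ B) {r : ℝ}
    (hr : 0 ≤ r) : (r : ℂ) • A ≤ (r : ℂ) • B := by
  rw [Matrix.le_iff, ← smul_sub]
  exact (Matrix.le_iff.mp h).smul (by exact_mod_cast hr)

theorem matrix_smul_le_smul_right {n : Type*} [Fintype n] {A : Matrix n n ℂ} (h : 0 ≤ A) {r s : ℝ}
    (hr : r ≤ s) : (r : ℂ) • A ≤ (s : ℂ) • A := by
  rw [Matrix.le_iff, ← sub_smul, ← Complex.ofReal_sub]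
  exact (nonneg_iff_posSemidef.mp h).smul (by exact_mod_cast sub_nonneg.mpr hr)

theorem relative_error_permSum {μ μH : Measure (Matrix β β ℂ)} (hk : k ^ 2 ≤ Fintype.card β)
    [Nonempty β] [IsProbabilityMeasure μ] (hμ : μ (UnitarySet β) = 1)
    (hμH : IsHaarOn (UnitarySet β) μH) {δ ε : ℝ} (hδ : 0 ≤ δ)
    (hε : 1 + ε = (1 + δ) * (1 + (k : ℝ) ^ 2 / Fintype.card β) *
      (1 + (k : ℝ) ^ 2 / (Fintype.card β : ℝ) ^ 2))
    (hlow : (choiMoment k μ - ((1 - δ : ℝ) : ℂ) • choiMoment k μH).PosSemidef)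
    (hupp : (((1 + δ : ℝ) : ℂ) • choiMoment k μH - choiMoment k μ).PosSemidef) :
    (((((Fintype.card β : ℝ) ^ k)⁻¹ : ℝ) : ℂ) • choiMoment k μ -
        (((1 - ε) * ((Fintype.card β ^ 2).ascFactorial k : ℝ)⁻¹ : ℝ) : ℂ) •
          permSum k β).PosSemidef ∧
      ((((1 + ε) * ((Fintype.card β ^ 2).ascFactorial k : ℝ)⁻¹ : ℝ) : ℂ) • permSum k β -
        ((((Fintype.card β : ℝ) ^ k)⁻¹ : ℝ) : ℂ) • choiMoment k μ).PosSemidef := by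
  rw [← Matrix.le_iff] at hlow hupp
  simp only [← Matrix.le_iff]
  set D := Fintype.card β
  have hD0 : 0 < D := Fintype.card_pos
  have hDR : (0 : ℝ) < D := Nat.cast_pos.mpr hD0
  have hkD : k ≤ D := (Nat.le_self_pow two_ne_zero k).trans hk
  have hdesc : (0 : ℝ) < D.descFactorial k := by
    exact_mod_cast Nat.descFactorial_pos.mpr hkD
  have hP : (0 : ℝ) < (D : ℝ) ^ k := pow_pos hDR k
  set P := (D : ℝ) ^ k with hPdef
  have hm' : P ^ 2 ≤ (D ^ 2).ascFactorial k := by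
    rw [hPdef, ← pow_mul, mul_comm, pow_mul]
    exact_mod_cast Nat.pow_succ_le_ascFactorial (D ^ 2) k
  have hm : (0 : ℝ) < (D ^ 2).ascFactorial k := (pow_pos hP 2).trans_le hm'
  set a := 1 + (k : ℝ) ^ 2 / D with ha
  set b := 1 + (k : ℝ) ^ 2 / (D : ℝ) ^ 2 with hb
  have ha1 : 1 ≤ a := le_add_of_nonneg_right (by positivity)
  have hb1 : 1 ≤ b := le_add_of_nonneg_right (by positivity)
  have hasc_le : (D.ascFactorial k : ℝ) ≤ P * a := by
    have h : (D : ℝ) * D.ascFactorial k ≤ P * (D + (k : ℝ) ^ 2) := by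
      rw [hPdef]
      exact_mod_cast mul_ascFactorial_le D hk
    refine le_of_mul_le_mul_left (h.trans_eq ?_) hDR
    rw [ha]
    field_simp
  have hm_le : ((D ^ 2).ascFactorial k : ℝ) ≤ P ^ 2 * b := by
    have h : (D : ℝ) ^ 2 * (D ^ 2).ascFactorial k ≤
        ((D : ℝ) ^ 2) ^ k * ((D : ℝ) ^ 2 + (k : ℝ) ^ 2) := by
      exact_mod_cast mul_ascFactorial_le (D ^ 2) (hk.trans (Nat.le_self_pow two_ne_zero D))
    refine le_of_mul_le_mul_left (h.trans_eq ?_) (pow_pos hDR 2)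
    rw [hb, hPdef, ← pow_mul, ← pow_mul, mul_comm 2 k]
    field_simp
  have hP_le : P ≤ a * D.descFactorial k := by
    have h : (D : ℝ) ^ (k + 1) ≤ (D + (k : ℝ) ^ 2) * D.descFactorial k := by
      exact_mod_cast pow_succ_le_mul_descFactorial D hk
    refine le_of_mul_le_mul_left (Eq.trans_le ?_ (h.trans_eq ?_)) hDR
    · rw [pow_succ']
    · rw [ha]
      field_simp
  have := hμH.1
  have hT := choiMoment_nonneg (k := k) hμH.2.1
  have hle : ((D.descFactorial k : ℝ) : ℂ) • choiMoment k μH ≤ permSum k β := by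
    exact_mod_cast smul_choiMoment_le_permSum hμH
  have hge : permSum k β ≤ ((D.ascFactorial k : ℝ) : ℂ) • choiMoment k μH := by
    have h := permSum_le_smul_choiMoment (k := k) hμH
    rw [Nat.ascFactorial_eq_prod_range]
    exact_mod_cast h
  have hA : 0 ≤ permSum k β := by
    refine le_trans ?_ hle
    simpa using matrix_smul_le_smul_right hT hdesc.le
  constructor
  · rcases le_or_gt (1 - ε) 0 with h0 | h0
    · have h1 := matrix_smul_le_smul_right hA
        (mul_nonpos_of_nonpos_of_nonneg h0 (inv_nonneg.mpr hm.le))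
      have h2 := matrix_smul_le_smul_right (choiMoment_nonneg (k := k) hμ) (inv_nonneg.mpr hP.le)
      rw [Complex.ofReal_zero, zero_smul] at h1 h2
      exact h1.trans h2
    · have hs : (1 - ε) * a ≤ 1 - δ := by
        have h1 : (1 + δ) * a ≤ 1 + ε := by
          rw [hε]
          exact le_mul_of_one_le_right (by positivity) hb1
        nlinarith [mul_nonneg hδ (sub_nonneg.mpr ha1),
          mul_nonneg (sub_nonneg.mpr ha1) (sub_nonneg.mpr ha1),
          mul_le_mul_of_nonneg_right h1 (zero_le_one.trans ha1)]
      have hδ1 : 0 ≤ 1 - δ := le_trans (by positivity) hs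
      have hc : (1 - ε) * ((D ^ 2).ascFactorial k : ℝ)⁻¹ * D.ascFactorial k ≤ P⁻¹ * (1 - δ) := by
        rw [← div_eq_mul_inv, div_mul_eq_mul_div, div_le_iff₀ hm, inv_mul_eq_div,
          div_mul_eq_mul_div, le_div_iff₀ hP]
        calc (1 - ε) * D.ascFactorial k * P ≤ (1 - ε) * (P * a) * P := by gcongr
          _ = (1 - ε) * a * P ^ 2 := by ring
          _ ≤ (1 - δ) * (D ^ 2).ascFactorial k := mul_le_mul hs hm' (sq_nonneg P) hδ1
      have h1 := matrix_smul_le_smul hge (mul_nonneg h0.le (inv_nonneg.mpr hm.le))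
      have h2 := matrix_smul_le_smul_right hT hc
      have h3 := matrix_smul_le_smul hlow (inv_nonneg.mpr hP.le)
      rw [smul_smul, ← Complex.ofReal_mul] at h1 h3
      exact h1.trans (h2.trans h3)
  · have hc : P⁻¹ * (1 + δ) ≤ (1 + ε) * ((D ^ 2).ascFactorial k : ℝ)⁻¹ * D.descFactorial k := by
      rw [← div_eq_mul_inv, div_mul_eq_mul_div, le_div_iff₀ hm, inv_mul_eq_div,
        div_mul_eq_mul_div, div_le_iff₀ hP, hε]
      calc (1 + δ) * (D ^ 2).ascFactorial k ≤ (1 + δ) * (P ^ 2 * b) := by gcongr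
        _ = (1 + δ) * (P * P * b) := by rw [sq]
        _ ≤ (1 + δ) * (a * D.descFactorial k * P * b) := by gcongr
        _ = _ := by ring
    have h1 := matrix_smul_le_smul hle (r := (1 + ε) * ((D ^ 2).ascFactorial k : ℝ)⁻¹) (by
      rw [hε]
      positivity)
    have h2 := matrix_smul_le_smul_right hT hc
    have h3 := matrix_smul_le_smul hupp (inv_nonneg.mpr hP.le)
    rw [smul_smul, ← Complex.ofReal_mul] at h1 h3
    exact h3.trans (h2.trans h1)

end RelativeError

/-- The Choi state of a unitary `k`-design with `ε'` relative error forms a state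
`k`-design on the doubled system with relative error
`ε = (1+ε')(1 + k² 2^{-N})(1 + k² 2^{-2N}) - 1`. -/
theorem choi_state_of_relative_design
    (k N : ℕ) (hk : 1 ≤ k) (hN : 1 ≤ N) (hkN : k ^ 2 ≤ 2 ^ N)
    (ε' : ℝ) (hε' : 0 ≤ ε')
    (μ : Measure (Matrix (Fin N → ZMod 2) (Fin N → ZMod 2) ℂ))
    (hμP : IsProbabilityMeasure μ) (hμU : μ (UnitarySet (Fin N → ZMod 2)) = 1)
    (μH : Measure (Matrix (Fin N → ZMod 2) (Fin N → ZMod 2) ℂ))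
    (hμH : IsHaarOn (UnitarySet (Fin N → ZMod 2)) μH)
    (hrel₁ : CompletelyPositive
      (fun X => kfold k μ X - ((1 - ε' : ℝ) : ℂ) • kfold k μH X))
    (hrel₂ : CompletelyPositive
      (fun X => ((1 + ε' : ℝ) : ℂ) • kfold k μH X - kfold k μ X))
    (ρE : Matrix (Fin k → (Fin N → ZMod 2) × (Fin N → ZMod 2))
      (Fin k → (Fin N → ZMod 2) × (Fin N → ZMod 2)) ℂ)
    (hρE : ρE = Matrix.of (fun X Y =>
      ∫ U, (tpow k (tensorWithId N U * eprProj N * (tensorWithId N U)ᴴ)) X Y ∂μ))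
    (ε : ℝ)
    (hε : ε = (1 + ε') * (1 + (k : ℝ) ^ 2 * (2 : ℝ) ^ (-(N : ℝ))) *
      (1 + (k : ℝ) ^ 2 * (2 : ℝ) ^ (-(2 * N : ℝ))) - 1) :
    (ρE - ((1 - ε : ℝ) : ℂ) •
        rhoHaar k ((Fin N → ZMod 2) × (Fin N → ZMod 2))).PosSemidef ∧
    (((1 + ε : ℝ) : ℂ) •
        rhoHaar k ((Fin N → ZMod 2) × (Fin N → ZMod 2)) - ρE).PosSemidef := by
  have hcard : Fintype.card (Fin N → ZMod 2) = 2 ^ N := by simp [ZMod.card]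
  have hρ : ρE = (((((2 ^ N : ℕ) : ℝ) ^ k)⁻¹ : ℝ) : ℂ) •
      (choiMoment k μ).submatrix unzip unzip := by
    rw [hρE]
    ext X Y
    simp [tpow_choi, Matrix.smul_apply, choiMoment, integral_const_mul]
  have hlow : (choiMoment k μ - ((1 - ε' : ℝ) : ℂ) • choiMoment k μH).PosSemidef := by
    refine (congrArg Matrix.PosSemidef ?_).mpr (posSemidef_choi hrel₁)
    ext ⟨x, y⟩ ⟨x', y'⟩
    simp [← kfold_single]
  have hupp : (((1 + ε' : ℝ) : ℂ) • choiMoment k μH - choiMoment k μ).PosSemidef := by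
    refine (congrArg Matrix.PosSemidef ?_).mpr (posSemidef_choi hrel₂)
    ext ⟨x, y⟩ ⟨x', y'⟩
    simp [← kfold_single]
  have h := relative_error_permSum (hcard ▸ hkN) hμU hμH hε' (ε := ε) (by
    rw [hε, hcard]
    norm_num [Real.rpow_neg, Real.rpow_mul, mul_comm, div_eq_mul_inv]) hlow hupp
  rw [hcard] at h
  rw [hρ, rhoHaar_prod, hcard]
  refine ⟨(congrArg Matrix.PosSemidef ?_).mpr (h.1.submatrix unzip),
    (congrArg Matrix.PosSemidef ?_).mpr (h.2.submatrix unzip)⟩ <;>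
  · ext X Y
    simp
    ring
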